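/- arXiv:2203.05724 — 3 statements merged into one kernel-verified Lean document; each statement's English description precedes it below -/
import Mathlib

section
/- Let X = (X₁,…,Xₙ) be a training sample of n i.i.d. draws from a distribution D, let Θ be the output of a (possibly randomized) learning algorithm applied to X, and let S, ξ be finite-valued random variables such that X → S → ξ forms a Markov chain and ξ = g(X,Θ) for a function g that is one-to-one with respect to the pair (X,Θ). Assume l(X̄,Θ̄) is sub-σ-Gaussian when (X̄,Θ̄) is distributed according to the product of the marginal laws of X and Θ, and assume the algorithm satisfies the layerwise information-loss bound E[R(Θ) − R_T(Θ)] ≤ exp(−(L/2)·log(1/η))·sqrt((2σ²/n)·I(X;Θ)) for some integer L ≥ 0 (the effective number of layers causing information loss) and some constant η ∈ (0,1). Then the expected generalization error satisfies E[R(Θ) − R_T(Θ)] ≤ exp(−(L/2)·log(1/η))·sqrt((2σ²/n)·I(X;S)). -/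
open scoped BigOperators

namespace Stmt1

variable {Ω : Type*} [Fintype Ω]

-- Marginal probability mass of a random variable `X` at value `x`.
open scoped Classical in
noncomputable def pm {α : Type*} (p : Ω → ℝ) (X : Ω → α) (x : α) : ℝ :=
  ∑ ω, if X ω = x then p ω else 0

/-- Mutual information `I(X;Y)` for finite-valued random variables. -/
noncomputable def mi {α β : Type*} [Fintype α] [Fintype β]
    (p : Ω → ℝ) (X : Ω → α) (Y : Ω → β) : ℝ :=
  ∑ x : α, ∑ y : β,
    pm p (fun ω => (X ω, Y ω)) (x, y) *
      Real.log (pm p (fun ω => (X ω, Y ω)) (x, y) / (pm p X x * pm p Y y))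

/-- `X → S → Y` forms a Markov chain: `X` and `Y` are conditionally
independent given `S`. -/
def MarkovChain {α β γ : Type*} (p : Ω → ℝ) (X : Ω → α) (S : Ω → β) (Y : Ω → γ) : Prop :=
  ∀ (x : α) (s : β) (y : γ),
    pm p (fun ω => (X ω, S ω, Y ω)) (x, s, y) * pm p S s =
      pm p (fun ω => (X ω, S ω)) (x, s) * pm p (fun ω => (S ω, Y ω)) (s, y)

/-- Population risk `R(θ) = E_{x ∼ D}[l(x,θ)]` for a data distribution `D`
on a finite example space. -/
noncomputable def popRisk {𝒳 𝒯 : Type*} [Fintype 𝒳]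
    (D : 𝒳 → ℝ) (l : 𝒳 → 𝒯 → ℝ) (θ : 𝒯) : ℝ :=
  ∑ x : 𝒳, D x * l x θ

/-- Empirical risk `R_T(θ) = (1/n) ∑ᵢ l(xᵢ,θ)` on a sample `xs`. -/
noncomputable def empRisk {𝒳 𝒯 : Type*} {n : ℕ}
    (l : 𝒳 → 𝒯 → ℝ) (xs : Fin n → 𝒳) (θ : 𝒯) : ℝ :=
  (1 / (n : ℝ)) * ∑ i : Fin n, l (xs i) θ

/-- Expected generalization error `E[R(Θ) − R_T(Θ)]` over the joint law of `(X,Θ)`. -/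
noncomputable def genErr {𝒳 𝒯 : Type*} [Fintype 𝒳] {n : ℕ}
    (p : Ω → ℝ) (D : 𝒳 → ℝ) (l : 𝒳 → 𝒯 → ℝ) (X : Ω → Fin n → 𝒳) (Θ : Ω → 𝒯) : ℝ :=
  ∑ ω, p ω * (popRisk D l (Θ ω) - empRisk l (X ω) (Θ ω))

theorem pm_nonneg' {α : Type*} (p : Ω → ℝ) (hp0 : ∀ ω, 0 ≤ p ω) (X : Ω → α) (x : α) :
    0 ≤ pm p X x := by
  unfold pm
  exact Finset.sum_nonneg fun ω _ => by split_ifs <;> simp [hp0]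

theorem pm_pos_of {α : Type*} (p : Ω → ℝ) (hp0 : ∀ ω, 0 ≤ p ω) (X : Ω → α) (ω : Ω)
    (h : p ω ≠ 0) : 0 < pm p X (X ω) := by
  unfold pm
  refine Finset.sum_pos' (fun ω _ => by split_ifs <;> simp [hp0]) ⟨ω, Finset.mem_univ _, ?_⟩
  simpa using lt_of_le_of_ne (hp0 ω) (Ne.symm h)

theorem pm_mono {α β : Type*} (p : Ω → ℝ) (hp0 : ∀ ω, 0 ≤ p ω) (X : Ω → α) (Y : Ω → β)
    (x : α) (y : β) (h : ∀ ω, X ω = x → Y ω = y) : pm p X x ≤ pm p Y y := by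
  unfold pm
  refine Finset.sum_le_sum fun ω _ => ?_
  by_cases h1 : X ω = x
  · simp [h1, h ω h1]
  · rw [if_neg h1]
    split_ifs <;> simp [hp0]

theorem pm_fst_sum {α β : Type*} [Fintype β] (p : Ω → ℝ) (X : Ω → α) (Y : Ω → β)
    (x : α) : ∑ y, pm p (fun ω => (X ω, Y ω)) (x, y) = pm p X x := by
  classical
  unfold pm
  rw [Finset.sum_comm]
  refine Finset.sum_congr rfl fun ω _ => ?_
  by_cases h : X ω = x <;> simp [h]

theorem mi_le_of_markov {α β γ δ : Type*} [Fintype α] [Fintype β] [Fintype γ]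
    (p : Ω → ℝ) (hp0 : ∀ ω, 0 ≤ p ω) (X : Ω → α) (T : Ω → β) (S : Ω → γ) (ξ : Ω → δ)
    (hmc : MarkovChain p X S ξ) (hX : ∀ ω ω', ξ ω = ξ ω' → X ω = X ω') :
    mi p X T ≤ mi p X S := by
  classical
  unfold mi
  refine Finset.sum_le_sum fun x _ => ?_
  have h1 : ∀ y, pm p (fun ω => (X ω, T ω)) (x, y) *
      Real.log (pm p (fun ω => (X ω, T ω)) (x, y) / (pm p X x * pm p T y)) ≤
      pm p (fun ω => (X ω, T ω)) (x, y) * Real.log (1 / pm p X x) := by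
    intro y
    rcases (pm_nonneg' p hp0 (fun ω => (X ω, T ω)) (x, y)).eq_or_lt with h | h
    · simp [← h]
    have hx : pm p (fun ω => (X ω, T ω)) (x, y) ≤ pm p X x :=
      pm_mono p hp0 _ _ _ _ (by simp +contextual)
    have hy : pm p (fun ω => (X ω, T ω)) (x, y) ≤ pm p T y :=
      pm_mono p hp0 _ _ _ _ (by simp +contextual)
    have hx0 := h.trans_le hx
    have hy0 := h.trans_le hy
    refine mul_le_mul_of_nonneg_left (Real.log_le_log (by positivity) ?_) h.le
    rw [div_le_div_iff₀ (by positivity) hx0]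
    nlinarith
  have h2 : ∀ s, pm p (fun ω => (X ω, S ω)) (x, s) *
      Real.log (pm p (fun ω => (X ω, S ω)) (x, s) / (pm p X x * pm p S s)) =
      pm p (fun ω => (X ω, S ω)) (x, s) * Real.log (1 / pm p X x) := by
    intro s
    rcases (pm_nonneg' p hp0 (fun ω => (X ω, S ω)) (x, s)).eq_or_lt with h | h
    · simp [← h]
    have he : pm p (fun ω => (X ω, S ω)) (x, s) = pm p S s := by
      unfold pm
      refine Finset.sum_congr rfl fun ω _ => ?_
      by_cases hs : S ω = s
      · by_cases hx : X ω = x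
        · simp [hs, hx]
        · have hz : p ω = 0 := by
            by_contra hne
            have hm := hmc x s (ξ ω)
            have h0 : pm p (fun ω => (X ω, S ω, ξ ω)) (x, s, ξ ω) = 0 := by
              unfold pm
              refine Finset.sum_eq_zero fun ω' _ => if_neg ?_
              intro hh
              simp only [Prod.mk.injEq] at hh
              exact hx ((hX ω' ω hh.2.2).symm.trans hh.1)
            have h3 := pm_pos_of p hp0 (fun ω => (S ω, ξ ω)) ω hne
            simp only [hs] at h3
            rw [h0, zero_mul] at hm
            exact (mul_pos h h3).ne hm
          simp [hz]
      · simp [hs]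
    have hs0 : pm p S s ≠ 0 := he ▸ h.ne'
    congr 2
    rw [he, mul_comm, ← div_div, div_self hs0]
  calc _ ≤ ∑ y, pm p (fun ω => (X ω, T ω)) (x, y) * Real.log (1 / pm p X x) :=
        Finset.sum_le_sum fun y _ => h1 y
    _ = ∑ s, pm p (fun ω => (X ω, S ω)) (x, s) * Real.log (1 / pm p X x) := by
        rw [← Finset.sum_mul, ← Finset.sum_mul, pm_fst_sum, pm_fst_sum]
    _ = _ := Finset.sum_congr rfl fun s _ => (h2 s).symm

/-- **Theorem 1.** Under the Markov chain `X → S → ξ` with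
`ξ = g(X,Θ)` one-to-one w.r.t. `(X,Θ)`, a sub-σ-Gaussian loss under the product of
the marginals, and the layerwise information-loss bound in terms of `I(X;Θ)`, the
expected generalization error is bounded by
`exp(−(L/2)·log(1/η))·√((2σ²/n)·I(X;S))`. -/
theorem generalization_bound_IB
    {𝒳 𝒯 𝒮 Ξ : Type*} [Fintype 𝒳] [Fintype 𝒯] [Fintype 𝒮] [Fintype Ξ]
    (n : ℕ) (hn : 0 < n)
    (p : Ω → ℝ) (hp0 : ∀ ω, 0 ≤ p ω) (hp1 : ∑ ω, p ω = 1)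
    (D : 𝒳 → ℝ) (hD0 : ∀ x, 0 ≤ D x) (hD1 : ∑ x : 𝒳, D x = 1)
    (X : Ω → Fin n → 𝒳) (Θ : Ω → 𝒯) (S : Ω → 𝒮) (ξ : Ω → Ξ)
    -- `X = (X₁,…,Xₙ)` are i.i.d. draws from `D`
    (hiid : ∀ xs : Fin n → 𝒳, pm p X xs = ∏ i : Fin n, D (xs i))
    (g : (Fin n → 𝒳) → 𝒯 → Ξ)
    (hmc : MarkovChain p X S ξ)
    (hg : ∀ ω, ξ ω = g (X ω) (Θ ω))
    (hinj : ∀ ω ω', g (X ω) (Θ ω) = g (X ω') (Θ ω') → X ω = X ω' ∧ Θ ω = Θ ω')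
    (l : 𝒳 → 𝒯 → ℝ) (σ : ℝ) (hσ : 0 ≤ σ)
    -- `l(X̄,Θ̄)` is sub-σ-Gaussian under the product of the marginal laws
    (hsubG : ∀ lam : ℝ,
      ∑ x : 𝒳, ∑ θ : 𝒯, D x * pm p Θ θ *
          Real.exp (lam * (l x θ - ∑ x' : 𝒳, ∑ θ' : 𝒯, D x' * pm p Θ θ' * l x' θ')) ≤
        Real.exp (lam ^ 2 * σ ^ 2 / 2))
    (L : ℕ) (η : ℝ) (hη0 : 0 < η) (hη1 : η < 1)
    -- layerwise information-loss bound in terms of `I(X;Θ)`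
    (hlayer : genErr p D l X Θ ≤
      Real.exp (-(L / 2 : ℝ) * Real.log (1 / η)) *
        Real.sqrt ((2 * σ ^ 2 / n) * mi p X Θ)) :
    genErr p D l X Θ ≤
      Real.exp (-(L / 2 : ℝ) * Real.log (1 / η)) *
        Real.sqrt ((2 * σ ^ 2 / n) * mi p X S) := by
  refine hlayer.trans (mul_le_mul_of_nonneg_left (Real.sqrt_le_sqrt ?_) (Real.exp_pos _).le)
  refine mul_le_mul_of_nonneg_left ?_ (by positivity)
  exact mi_le_of_markov p hp0 X Θ S ξ hmc
    (fun ω ω' h => (hinj ω ω' (by rw [← hg, ← hg, h])).1)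

end Stmt1
end

section
/- Let X = (X₁,…,Xₙ) be a training sample of n i.i.d. draws from a distribution D, let Θ be the output of a (possibly randomized) learning algorithm applied to X, and let S, ξ be finite-valued random variables such that X → S → ξ forms a Markov chain and ξ = g(X,Θ) for a function g that is one-to-one with respect to the pair (X,Θ). Assume l(X̄,Θ̄) is sub-σ-Gaussian when (X̄,Θ̄) is distributed according to the product of the marginal laws of X and Θ, and assume the algorithm satisfies the layerwise information-loss bound E[R(Θ) − R_T(Θ)] ≤ exp(−(L/2)·log(1/η))·sqrt((2σ²/n)·I(X;Θ)) for some integer L ≥ 0 and some constant η ∈ (0,1). If S takes values in a set of cardinality |S|, then E[R(Θ) − R_T(Θ)] ≤ exp(−(L/2)·log(1/η))·sqrt((2σ²/n)·log|S|). -/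
open scoped BigOperators

namespace Stmt2

variable {Ω : Type*} [Fintype Ω]

-- Marginal probability mass of a random variable `X` at value `x`.
open scoped Classical in
noncomputable def pm {α : Type*} (p : Ω → ℝ) (X : Ω → α) (x : α) : ℝ :=
  ∑ ω, if X ω = x then p ω else 0

/-- Mutual information `I(X;Y)` for finite-valued random variables. -/
noncomputable def mi {α β : Type*} [Fintype α] [Fintype β]
    (p : Ω → ℝ) (X : Ω → α) (Y : Ω → β) : ℝ :=
  ∑ x : α, ∑ y : β,
    pm p (fun ω => (X ω, Y ω)) (x, y) *
      Real.log (pm p (fun ω => (X ω, Y ω)) (x, y) / (pm p X x * pm p Y y))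

/-- `X → S → Y` forms a Markov chain: `X` and `Y` are conditionally
independent given `S`. -/
def MarkovChain {α β γ : Type*} (p : Ω → ℝ) (X : Ω → α) (S : Ω → β) (Y : Ω → γ) : Prop :=
  ∀ (x : α) (s : β) (y : γ),
    pm p (fun ω => (X ω, S ω, Y ω)) (x, s, y) * pm p S s =
      pm p (fun ω => (X ω, S ω)) (x, s) * pm p (fun ω => (S ω, Y ω)) (s, y)

/-- Population risk `R(θ) = E_{x ∼ D}[l(x,θ)]` for a data distribution `D`
on a finite example space. -/
noncomputable def popRisk {𝒳 𝒯 : Type*} [Fintype 𝒳]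
    (D : 𝒳 → ℝ) (l : 𝒳 → 𝒯 → ℝ) (θ : 𝒯) : ℝ :=
  ∑ x : 𝒳, D x * l x θ

/-- Empirical risk `R_T(θ) = (1/n) ∑ᵢ l(xᵢ,θ)` on a sample `xs`. -/
noncomputable def empRisk {𝒳 𝒯 : Type*} {n : ℕ}
    (l : 𝒳 → 𝒯 → ℝ) (xs : Fin n → 𝒳) (θ : 𝒯) : ℝ :=
  (1 / (n : ℝ)) * ∑ i : Fin n, l (xs i) θ

/-- Expected generalization error `E[R(Θ) − R_T(Θ)]` over the joint law of `(X,Θ)`. -/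
noncomputable def genErr {𝒳 𝒯 : Type*} [Fintype 𝒳] {n : ℕ}
    (p : Ω → ℝ) (D : 𝒳 → ℝ) (l : 𝒳 → 𝒯 → ℝ) (X : Ω → Fin n → 𝒳) (Θ : Ω → 𝒯) : ℝ :=
  ∑ ω, p ω * (popRisk D l (Θ ω) - empRisk l (X ω) (Θ ω))

open scoped Classical in
lemma aux_pm_nonneg {α : Type*} (p : Ω → ℝ) (hp0 : ∀ ω, 0 ≤ p ω) (X : Ω → α) (x : α) :
    0 ≤ pm p X x := by
  unfold pm
  refine Finset.sum_nonneg fun ω _ => ?_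
  split_ifs
  · exact hp0 ω
  · exact le_rfl

open scoped Classical in
lemma aux_pm_pos {α : Type*} (p : Ω → ℝ) (hp0 : ∀ ω, 0 ≤ p ω) (X : Ω → α) (ω : Ω)
    (h : 0 < p ω) : 0 < pm p X (X ω) := by
  unfold pm
  refine Finset.sum_pos' (fun ω _ => ?_) ⟨ω, Finset.mem_univ _, by simpa using h⟩
  split_ifs
  · exact hp0 ω
  · exact le_rfl

open scoped Classical in
lemma aux_pm_exists {α : Type*} (p : Ω → ℝ) (hp0 : ∀ ω, 0 ≤ p ω) (X : Ω → α) (x : α)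
    (h : pm p X x ≠ 0) : ∃ ω, X ω = x ∧ 0 < p ω := by
  unfold pm at h
  obtain ⟨ω, -, hω⟩ := Finset.exists_ne_zero_of_sum_ne_zero h
  by_cases hx : X ω = x
  · rw [if_pos hx] at hω
    exact ⟨ω, hx, lt_of_le_of_ne (hp0 ω) (Ne.symm hω)⟩
  · rw [if_neg hx] at hω
    exact absurd rfl hω

open scoped Classical in
lemma aux_pm_sum {α : Type*} [Fintype α] (p : Ω → ℝ) (X : Ω → α) :
    ∑ x, pm p X x = ∑ ω, p ω := by
  unfold pm
  rw [Finset.sum_comm]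
  simp

open scoped Classical in
lemma aux_pm_marg {α β : Type*} [Fintype β] (p : Ω → ℝ) (X : Ω → α) (Y : Ω → β) (x : α) :
    ∑ y, pm p (fun ω => (X ω, Y ω)) (x, y) = pm p X x := by
  unfold pm
  rw [Finset.sum_comm]
  refine Finset.sum_congr rfl fun ω _ => ?_
  by_cases hx : X ω = x <;> simp [hx]

open scoped Classical in
lemma aux_pm_le {α β : Type*} (p : Ω → ℝ) (hp0 : ∀ ω, 0 ≤ p ω) (X : Ω → α) (Y : Ω → β)
    (x : α) (y : β) : pm p (fun ω => (X ω, Y ω)) (x, y) ≤ pm p Y y := by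
  unfold pm
  refine Finset.sum_le_sum fun ω _ => ?_
  by_cases hx : X ω = x <;> by_cases hy : Y ω = y <;> simp [hx, hy, hp0 ω]

open scoped Classical in
lemma aux_mi_le {α β γ : Type*} [Fintype α] [Fintype β] [Fintype γ]
    (p : Ω → ℝ) (hp0 : ∀ ω, 0 ≤ p ω) (hp1 : ∑ ω, p ω = 1)
    (X : Ω → α) (Y : Ω → β) (S : Ω → γ)
    (hdet : ∀ ω ω', 0 < p ω → 0 < p ω' → S ω = S ω' → X ω = X ω') :
    mi p X Y ≤ Real.log (Fintype.card γ) := by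
  have hne : Nonempty Ω := by
    by_contra hcon
    rw [not_nonempty_iff] at hcon
    simp at hp1
  have : Nonempty γ := hne.map S
  have hN : (0 : ℝ) < Fintype.card γ := by exact_mod_cast Fintype.card_pos
  set N : ℝ := (Fintype.card γ : ℝ) with hNdef
  have hterm : ∀ x y, pm p (fun ω => (X ω, Y ω)) (x, y) *
      Real.log (pm p (fun ω => (X ω, Y ω)) (x, y) / (pm p X x * pm p Y y)) ≤
      pm p (fun ω => (X ω, Y ω)) (x, y) * (Real.log N - 1 + 1 / (N * pm p X x)) := by
    intro x y
    have h0 := aux_pm_nonneg p hp0 (fun ω => (X ω, Y ω)) (x, y)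
    rcases h0.eq_or_lt with h | h
    · rw [← h]; simp
    refine mul_le_mul_of_nonneg_left ?_ h0
    have hy := aux_pm_le p hp0 X Y x y
    have hx : 0 < pm p X x := by
      obtain ⟨ω, h1, h2⟩ := aux_pm_exists p hp0 _ _ h.ne'
      have h3 : X ω = x := congrArg Prod.fst h1
      rw [← h3]
      exact aux_pm_pos p hp0 X ω h2
    generalize pm p (fun ω => (X ω, Y ω)) (x, y) = a at *
    generalize pm p X x = b at *
    generalize pm p Y y = c at *
    have hc : 0 < c := h.trans_le hy
    have h1 : a / (b * c) ≤ 1 / b := by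
      rw [div_le_div_iff₀ (by positivity) hx]
      nlinarith
    have h2 : Real.log (a / (b * c)) ≤ Real.log (1 / b) :=
      Real.log_le_log (by positivity) h1
    have h3 : Real.log (1 / b) = Real.log N + Real.log (1 / (N * b)) := by
      rw [← Real.log_mul hN.ne' (by positivity)]
      congr 1
      field_simp
    have h4 := Real.log_le_sub_one_of_pos (show 0 < 1 / (N * b) by positivity)
    linarith
  have hsupp : ((Finset.univ.filter fun x => pm p X x ≠ 0).card : ℝ) ≤ N := by
    have hex : ∀ x, pm p X x ≠ 0 → ∃ ω, X ω = x ∧ 0 < p ω := aux_pm_exists p hp0 X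
    rw [hNdef]
    norm_cast
    let f : α → γ := fun x => if h : pm p X x ≠ 0 then S (hex x h).choose else S hne.some
    rw [← Finset.card_univ]
    refine Finset.card_le_card_of_injOn f (fun _ _ => Finset.mem_coe.2 (Finset.mem_univ _)) ?_
    intro x hx x' hx' hf
    have hx1 : pm p X x ≠ 0 := by simpa using hx
    have hx2 : pm p X x' ≠ 0 := by simpa using hx'
    simp only [f, dif_pos hx1, dif_pos hx2] at hf
    have e1 := (hex x hx1).choose_spec
    have e2 := (hex x' hx2).choose_spec
    rw [← e1.1, ← e2.1]
    exact hdet _ _ e1.2 e2.2 hf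
  calc mi p X Y ≤ ∑ x, ∑ y, pm p (fun ω => (X ω, Y ω)) (x, y) *
        (Real.log N - 1 + 1 / (N * pm p X x)) :=
        Finset.sum_le_sum fun x _ => Finset.sum_le_sum fun y _ => hterm x y
    _ = ∑ x, (pm p X x * (Real.log N - 1) + if pm p X x ≠ 0 then 1 / N else 0) := by
        refine Finset.sum_congr rfl fun x _ => ?_
        rw [← Finset.sum_mul, aux_pm_marg]
        by_cases h : pm p X x = 0
        · simp [h]
        · rw [if_pos h]
          field_simp
    _ = (Real.log N - 1) + (Finset.univ.filter fun x => pm p X x ≠ 0).card * (1 / N) := by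
        rw [Finset.sum_add_distrib, ← Finset.sum_mul, aux_pm_sum, hp1, one_mul,
          ← Finset.sum_filter, Finset.sum_const, nsmul_eq_mul]
    _ ≤ Real.log N := by
        have : ((Finset.univ.filter fun x => pm p X x ≠ 0).card : ℝ) * (1 / N) ≤ 1 := by
          rw [mul_one_div, div_le_one hN]
          exact hsupp
        linarith

/-- **Corollary 1.** Under the Markov chain `X → S → ξ` with
`ξ = g(X,Θ)` one-to-one w.r.t. `(X,Θ)`, a sub-σ-Gaussian loss under the product of
the marginals, and the layerwise information-loss bound in terms of `I(X;Θ)`,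
if `S` takes values in a set of cardinality `|S|`, then the expected generalization
error is bounded by `exp(−(L/2)·log(1/η))·√((2σ²/n)·log|S|)`. -/
theorem generalization_bound_latent_cardinality
    {𝒳 𝒯 𝒮 Ξ : Type*} [Fintype 𝒳] [Fintype 𝒯] [Fintype 𝒮] [Fintype Ξ]
    (n : ℕ) (hn : 0 < n)
    (p : Ω → ℝ) (hp0 : ∀ ω, 0 ≤ p ω) (hp1 : ∑ ω, p ω = 1)
    (D : 𝒳 → ℝ) (hD0 : ∀ x, 0 ≤ D x) (hD1 : ∑ x : 𝒳, D x = 1)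
    (X : Ω → Fin n → 𝒳) (Θ : Ω → 𝒯) (S : Ω → 𝒮) (ξ : Ω → Ξ)
    -- `X = (X₁,…,Xₙ)` are i.i.d. draws from `D`
    (hiid : ∀ xs : Fin n → 𝒳, pm p X xs = ∏ i : Fin n, D (xs i))
    (g : (Fin n → 𝒳) → 𝒯 → Ξ)
    (hmc : MarkovChain p X S ξ)
    (hg : ∀ ω, ξ ω = g (X ω) (Θ ω))
    (hinj : ∀ ω ω', g (X ω) (Θ ω) = g (X ω') (Θ ω') → X ω = X ω' ∧ Θ ω = Θ ω')
    (l : 𝒳 → 𝒯 → ℝ) (σ : ℝ) (hσ : 0 ≤ σ)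
    -- `l(X̄,Θ̄)` is sub-σ-Gaussian under the product of the marginal laws
    (hsubG : ∀ lam : ℝ,
      ∑ x : 𝒳, ∑ θ : 𝒯, D x * pm p Θ θ *
          Real.exp (lam * (l x θ - ∑ x' : 𝒳, ∑ θ' : 𝒯, D x' * pm p Θ θ' * l x' θ')) ≤
        Real.exp (lam ^ 2 * σ ^ 2 / 2))
    (L : ℕ) (η : ℝ) (hη0 : 0 < η) (hη1 : η < 1)
    -- layerwise information-loss bound in terms of `I(X;Θ)`
    (hlayer : genErr p D l X Θ ≤
      Real.exp (-(L / 2 : ℝ) * Real.log (1 / η)) *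
        Real.sqrt ((2 * σ ^ 2 / n) * mi p X Θ)) :
    genErr p D l X Θ ≤
      Real.exp (-(L / 2 : ℝ) * Real.log (1 / η)) *
        Real.sqrt ((2 * σ ^ 2 / n) * Real.log (Fintype.card 𝒮)) := by
  refine hlayer.trans ?_
  refine mul_le_mul_of_nonneg_left (Real.sqrt_le_sqrt ?_) (Real.exp_pos _).le
  refine mul_le_mul_of_nonneg_left ?_ (by positivity)
  refine aux_mi_le p hp0 hp1 X Θ S ?_
  intro ω ω' hω hω' hS
  have h1 := hmc (X ω) (S ω) (ξ ω')
  have h2 : 0 < pm p (fun ω => (X ω, S ω)) (X ω, S ω) :=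
    aux_pm_pos p hp0 (fun ω => (X ω, S ω)) ω hω
  have h3 : 0 < pm p (fun ω => (S ω, ξ ω)) (S ω, ξ ω') := by
    rw [hS]
    exact aux_pm_pos p hp0 (fun ω => (S ω, ξ ω)) ω' hω'
  have h4 : pm p (fun ω => (X ω, S ω, ξ ω)) (X ω, S ω, ξ ω') ≠ 0 := by
    intro h
    rw [h, zero_mul] at h1
    exact (mul_pos h2 h3).ne h1
  obtain ⟨ω₀, h5, -⟩ := aux_pm_exists p hp0 _ _ h4
  simp only [Prod.mk.injEq] at h5
  obtain ⟨h6, -, h7⟩ := h5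
  rw [hg, hg] at h7
  rw [← h6]
  exact (hinj ω₀ ω' h7).1

end Stmt2
end

section
/- Let X = (X₁,…,Xₙ) be a training sample of n i.i.d. draws from a distribution D, let Θ be the output of a (possibly randomized) learning algorithm applied to X, and let S, ξ be random variables such that X → S → ξ forms a Markov chain and ξ = g(X,Θ) for a function g that is one-to-one with respect to the pair (X,Θ). Assume l(X̄,Θ̄) is sub-σ-Gaussian when (X̄,Θ̄) is distributed according to the product of the marginal laws of X and Θ, and assume the algorithm satisfies the layerwise information-loss bound E[R(Θ) − R_T(Θ)] ≤ exp(−(L/2)·log(1/η))·sqrt((2σ²/n)·I(X;Θ)) for some integer L ≥ 0 and some constant η ∈ (0,1). Suppose S takes values in a d-dimensional space with each coordinate bounded in absolute value by M, and S is quantized so that it takes at most (2M·√(d·n))^d distinct values (corresponding to covering [−M,M]^d by cubes of side length 1/√(d·n)). Then E[R(Θ) − R_T(Θ)] ≤ exp(−(L/2)·log(1/η))·σ·sqrt(d·log(d)/n + 2·log(2M)·d/n + d·log(n)/n). -/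
open scoped BigOperators

namespace Stmt3

variable {Ω : Type*} [Fintype Ω]

-- Marginal probability mass of a random variable `X` at value `x`.
open scoped Classical in
noncomputable def pm {α : Type*} (p : Ω → ℝ) (X : Ω → α) (x : α) : ℝ :=
  ∑ ω, if X ω = x then p ω else 0

/-- Mutual information `I(X;Y)` for finite-valued random variables. -/
noncomputable def mi {α β : Type*} [Fintype α] [Fintype β]
    (p : Ω → ℝ) (X : Ω → α) (Y : Ω → β) : ℝ :=
  ∑ x : α, ∑ y : β,
    pm p (fun ω => (X ω, Y ω)) (x, y) *
      Real.log (pm p (fun ω => (X ω, Y ω)) (x, y) / (pm p X x * pm p Y y))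

/-- `X → S → Y` forms a Markov chain: `X` and `Y` are conditionally
independent given `S`. -/
def MarkovChain {α β γ : Type*} (p : Ω → ℝ) (X : Ω → α) (S : Ω → β) (Y : Ω → γ) : Prop :=
  ∀ (x : α) (s : β) (y : γ),
    pm p (fun ω => (X ω, S ω, Y ω)) (x, s, y) * pm p S s =
      pm p (fun ω => (X ω, S ω)) (x, s) * pm p (fun ω => (S ω, Y ω)) (s, y)

/-- Population risk `R(θ) = E_{x ∼ D}[l(x,θ)]` for a data distribution `D`
on a finite example space. -/
noncomputable def popRisk {𝒳 𝒯 : Type*} [Fintype 𝒳]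
    (D : 𝒳 → ℝ) (l : 𝒳 → 𝒯 → ℝ) (θ : 𝒯) : ℝ :=
  ∑ x : 𝒳, D x * l x θ

/-- Empirical risk `R_T(θ) = (1/n) ∑ᵢ l(xᵢ,θ)` on a sample `xs`. -/
noncomputable def empRisk {𝒳 𝒯 : Type*} {n : ℕ}
    (l : 𝒳 → 𝒯 → ℝ) (xs : Fin n → 𝒳) (θ : 𝒯) : ℝ :=
  (1 / (n : ℝ)) * ∑ i : Fin n, l (xs i) θ

/-- Expected generalization error `E[R(Θ) − R_T(Θ)]` over the joint law of `(X,Θ)`. -/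
noncomputable def genErr {𝒳 𝒯 : Type*} [Fintype 𝒳] {n : ℕ}
    (p : Ω → ℝ) (D : 𝒳 → ℝ) (l : 𝒳 → 𝒯 → ℝ) (X : Ω → Fin n → 𝒳) (Θ : Ω → 𝒯) : ℝ :=
  ∑ ω, p ω * (popRisk D l (Θ ω) - empRisk l (X ω) (Θ ω))

theorem pm_nonneg {α : Type*} (p : Ω → ℝ) (hp0 : ∀ ω, 0 ≤ p ω) (X : Ω → α) (x : α) :
    0 ≤ pm p X x := by
  unfold pm
  refine Finset.sum_nonneg fun ω _ => ?_
  split_ifs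
  · exact hp0 ω
  · exact le_rfl

theorem pm_pos {α : Type*} (p : Ω → ℝ) (hp0 : ∀ ω, 0 ≤ p ω) (X : Ω → α) (ω : Ω)
    (h : 0 < p ω) (x : α) (hx : X ω = x) : 0 < pm p X x := by
  unfold pm
  refine Finset.sum_pos' (fun ω _ => ?_) ⟨ω, Finset.mem_univ _, by simpa [hx] using h⟩
  split_ifs
  · exact hp0 ω
  · exact le_rfl

theorem pm_exists {α : Type*} (p : Ω → ℝ) (hp0 : ∀ ω, 0 ≤ p ω) (X : Ω → α) (x : α)
    (h : pm p X x ≠ 0) : ∃ ω, X ω = x ∧ 0 < p ω := by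
  unfold pm at h
  obtain ⟨ω, _, hω⟩ := Finset.exists_ne_zero_of_sum_ne_zero h
  split_ifs at hω with hx
  · exact ⟨ω, hx, lt_of_le_of_ne (hp0 ω) (Ne.symm hω)⟩
  · exact absurd rfl hω

theorem pm_sum {α : Type*} [Fintype α] (p : Ω → ℝ) (X : Ω → α) :
    ∑ x, pm p X x = ∑ ω, p ω := by
  classical
  unfold pm
  rw [Finset.sum_comm]
  refine Finset.sum_congr rfl fun ω _ => ?_
  simp

theorem pm_pair_sum {α β : Type*} [Fintype β] (p : Ω → ℝ) (X : Ω → α) (Y : Ω → β) (x : α) :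
    ∑ y, pm p (fun ω => (X ω, Y ω)) (x, y) = pm p X x := by
  classical
  unfold pm
  rw [Finset.sum_comm]
  refine Finset.sum_congr rfl fun ω _ => ?_
  by_cases h : X ω = x <;> simp [h]

theorem pm_pair_le_right {α β : Type*} (p : Ω → ℝ) (hp0 : ∀ ω, 0 ≤ p ω)
    (X : Ω → α) (Y : Ω → β) (x : α) (y : β) :
    pm p (fun ω => (X ω, Y ω)) (x, y) ≤ pm p Y y := by
  classical
  unfold pm
  refine Finset.sum_le_sum fun ω _ => ?_
  have := hp0 ω
  by_cases h : X ω = x <;> by_cases h' : Y ω = y <;> simp [h, h', this]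

theorem pm_pair_le_left {α β : Type*} (p : Ω → ℝ) (hp0 : ∀ ω, 0 ≤ p ω)
    (X : Ω → α) (Y : Ω → β) (x : α) (y : β) :
    pm p (fun ω => (X ω, Y ω)) (x, y) ≤ pm p X x := by
  classical
  unfold pm
  refine Finset.sum_le_sum fun ω _ => ?_
  have := hp0 ω
  by_cases h : X ω = x <;> by_cases h' : Y ω = y <;> simp [h, h', this]

/-- Mutual information is at most the log of any bound on the support size. -/
theorem mi_le_log {α β : Type*} [Fintype α] [Fintype β]
    (p : Ω → ℝ) (hp0 : ∀ ω, 0 ≤ p ω) (hp1 : ∑ ω, p ω = 1) (X : Ω → α) (Y : Ω → β)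
    (T : Finset α) (hT : ∀ x, pm p X x ≠ 0 → x ∈ T) (K : ℝ) (hK : 0 < K)
    (hTK : (T.card : ℝ) ≤ K) : mi p X Y ≤ Real.log K := by
  classical
  have term : ∀ x y, pm p (fun ω => (X ω, Y ω)) (x, y) *
      Real.log (pm p (fun ω => (X ω, Y ω)) (x, y) / (pm p X x * pm p Y y)) ≤
      pm p (fun ω => (X ω, Y ω)) (x, y) * ((pm p X x)⁻¹ / K - 1 + Real.log K) := by
    intro x y
    have h0 := pm_nonneg p hp0 (fun ω => (X ω, Y ω)) (x, y)
    rcases h0.eq_or_lt with h0 | h0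
    · rw [← h0]; simp
    · have hr := pm_pair_le_right p hp0 X Y x y
      have hl := pm_pair_le_left p hp0 X Y x y
      set q := pm p (fun ω => (X ω, Y ω)) (x, y)
      have hx : 0 < pm p X x := h0.trans_le hl
      have hy : 0 < pm p Y y := h0.trans_le hr
      refine mul_le_mul_of_nonneg_left ?_ h0.le
      have hle : q / (pm p X x * pm p Y y) ≤ (pm p X x)⁻¹ := by
        rw [div_le_iff₀ (by positivity)]
        field_simp
        exact hr
      have h1 := Real.log_le_log (by positivity) hle
      have h2 := Real.log_le_sub_one_of_pos (x := (pm p X x)⁻¹ / K) (by positivity)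
      rw [Real.log_div (by positivity) hK.ne'] at h2
      linarith
  have inner : ∀ x, ∑ y, pm p (fun ω => (X ω, Y ω)) (x, y) *
      ((pm p X x)⁻¹ / K - 1 + Real.log K) ≤
      (if x ∈ T then 1 / K else 0) + pm p X x * (Real.log K - 1) := by
    intro x
    rw [← Finset.sum_mul, pm_pair_sum]
    by_cases h : pm p X x = 0
    · rw [h]
      split_ifs
      · simp [hK.le]
      · simp
    · rw [if_pos (hT x h)]
      apply le_of_eq
      field_simp
      ring
  unfold mi
  calc _ ≤ ∑ x, ((if x ∈ T then 1 / K else 0) + pm p X x * (Real.log K - 1)) :=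
        Finset.sum_le_sum fun x _ =>
          (Finset.sum_le_sum fun y _ => term x y).trans (inner x)
    _ = T.card / K + (Real.log K - 1) := by
        rw [Finset.sum_add_distrib, ← Finset.sum_mul, pm_sum, hp1]
        simp [div_eq_mul_inv]
    _ ≤ Real.log K := by
        have : (T.card : ℝ) / K ≤ 1 := (div_le_one hK).2 hTK
        linarith

/-- **Corollary 2.** Under the Markov chain `X → S → ξ` with
`ξ = g(X,Θ)` one-to-one w.r.t. `(X,Θ)`, a sub-σ-Gaussian loss under the product of
the marginals, and the layerwise information-loss bound in terms of `I(X;Θ)`,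
if `S` takes values in a `d`-dimensional space with each coordinate bounded in
absolute value by `M` and is quantized to at most `(2M·√(d·n))^d` distinct values
(covering `[−M,M]^d` by cubes of side `1/√(d·n)`), then the expected generalization
error is bounded by
`exp(−(L/2)·log(1/η))·σ·√(d·log(d)/n + 2·log(2M)·d/n + d·log(n)/n)`. -/
theorem generalization_bound_latent_dimension
    {𝒳 𝒯 Ξ : Type*} [Fintype 𝒳] [Fintype 𝒯] [Fintype Ξ]
    (n : ℕ) (hn : 0 < n) (d : ℕ) (M : ℝ)
    (p : Ω → ℝ) (hp0 : ∀ ω, 0 ≤ p ω) (hp1 : ∑ ω, p ω = 1)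
    (D : 𝒳 → ℝ) (hD0 : ∀ x, 0 ≤ D x) (hD1 : ∑ x : 𝒳, D x = 1)
    (X : Ω → Fin n → 𝒳) (Θ : Ω → 𝒯) (S : Ω → (Fin d → ℝ)) (ξ : Ω → Ξ)
    -- each coordinate of `S` is bounded in absolute value by `M`
    (hSbd : ∀ ω i, |S ω i| ≤ M)
    -- `S` is quantized: it takes at most `(2M·√(d·n))^d` distinct values
    (V : Finset (Fin d → ℝ)) (hSV : ∀ ω, S ω ∈ V)
    (hVcard : (V.card : ℝ) ≤ (2 * M * Real.sqrt (d * n)) ^ d)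
    -- `X = (X₁,…,Xₙ)` are i.i.d. draws from `D`
    (hiid : ∀ xs : Fin n → 𝒳, pm p X xs = ∏ i : Fin n, D (xs i))
    (g : (Fin n → 𝒳) → 𝒯 → Ξ)
    (hmc : MarkovChain p X S ξ)
    (hg : ∀ ω, ξ ω = g (X ω) (Θ ω))
    (hinj : ∀ ω ω', g (X ω) (Θ ω) = g (X ω') (Θ ω') → X ω = X ω' ∧ Θ ω = Θ ω')
    (l : 𝒳 → 𝒯 → ℝ) (σ : ℝ) (hσ : 0 ≤ σ)
    -- `l(X̄,Θ̄)` is sub-σ-Gaussian under the product of the marginal laws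
    (hsubG : ∀ lam : ℝ,
      ∑ x : 𝒳, ∑ θ : 𝒯, D x * pm p Θ θ *
          Real.exp (lam * (l x θ - ∑ x' : 𝒳, ∑ θ' : 𝒯, D x' * pm p Θ θ' * l x' θ')) ≤
        Real.exp (lam ^ 2 * σ ^ 2 / 2))
    (L : ℕ) (η : ℝ) (hη0 : 0 < η) (hη1 : η < 1)
    -- layerwise information-loss bound in terms of `I(X;Θ)`
    (hlayer : genErr p D l X Θ ≤
      Real.exp (-(L / 2 : ℝ) * Real.log (1 / η)) *
        Real.sqrt ((2 * σ ^ 2 / n) * mi p X Θ)) :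
    genErr p D l X Θ ≤
      Real.exp (-(L / 2 : ℝ) * Real.log (1 / η)) *
        (σ * Real.sqrt (d * Real.log d / n + 2 * Real.log (2 * M) * d / n +
          d * Real.log n / n)) := by
  classical
  obtain ⟨ω₀⟩ : Nonempty Ω := by
    by_contra h
    rw [not_nonempty_iff] at h
    simp at hp1
  have key : ∀ ω ω', 0 < p ω → 0 < p ω' → S ω = S ω' → X ω = X ω' := by
    intro ω ω' h h' hS
    have e := hmc (X ω) (S ω) (ξ ω')
    have a := pm_pos p hp0 (fun ω => (X ω, S ω)) ω h (X ω, S ω) rfl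
    have b := pm_pos p hp0 (fun ω => (S ω, ξ ω)) ω' h' (S ω, ξ ω') (by simp [hS])
    have c : pm p (fun ω => (X ω, S ω, ξ ω)) (X ω, S ω, ξ ω') ≠ 0 := by
      intro hc
      rw [hc, zero_mul] at e
      exact (mul_pos a b).ne e
    obtain ⟨w, hw, _⟩ := pm_exists p hp0 _ _ c
    simp only [Prod.mk.injEq] at hw
    have := hinj w ω' (by rw [← hg, ← hg]; exact hw.2.2)
    rw [← hw.1, this.1]
  have hVpos : 0 < V.card := Finset.card_pos.2 ⟨_, hSV ω₀⟩
  have hVpos' : (0 : ℝ) < V.card := by exact_mod_cast hVpos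
  have hV1 : (1 : ℝ) ≤ V.card := by exact_mod_cast hVpos
  have hmi : mi p X Θ ≤ Real.log V.card := by
    refine mi_le_log p hp0 hp1 X Θ ((Finset.univ.filter fun ω => 0 < p ω).image X) ?_ _
      hVpos' ?_
    · intro x hx
      obtain ⟨ω, h1, h2⟩ := pm_exists p hp0 X x hx
      exact Finset.mem_image.2 ⟨ω, by simpa using h2, h1⟩
    · have hex : ∀ x ∈ (Finset.univ.filter fun ω => 0 < p ω).image X,
          ∃ ω, X ω = x ∧ 0 < p ω := by
        intro x hx
        obtain ⟨ω, h1, h2⟩ := Finset.mem_image.1 hx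
        exact ⟨ω, h2, by simpa using h1⟩
      haveI : Nonempty Ω := ⟨ω₀⟩
      choose! f hf using hex
      exact_mod_cast Finset.card_le_card_of_injOn (fun x => S (f x)) (fun x _ => hSV _) (by
        intro x hx y hy hxy
        have := key _ _ (hf x hx).2 (hf y hy).2 hxy
        rwa [(hf x hx).1, (hf y hy).1] at this)
  have hnR : (0 : ℝ) < n := by exact_mod_cast hn
  have hlog : 2 * Real.log V.card ≤
      d * Real.log d + 2 * Real.log (2 * M) * d + d * Real.log n := by
    rcases Nat.eq_zero_or_pos d with hd | hd
    · subst hd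
      have : (V.card : ℝ) ≤ 1 := by simpa using hVcard
      have h1 : (V.card : ℝ) = 1 := le_antisymm this hV1
      simp [h1]
    · have hdR : (0 : ℝ) < d := by exact_mod_cast hd
      have hM0 : 0 ≤ M := (abs_nonneg _).trans (hSbd ω₀ ⟨0, hd⟩)
      have hM : 0 < M := by
        rcases hM0.eq_or_lt with h | h
        · rw [← h] at hVcard
          simp [hd.ne'] at hVcard
          simp [hVcard] at hVpos
        · exact h
      have h := Real.log_le_log hVpos' hVcard
      rw [Real.log_pow, Real.log_mul (by positivity) (by positivity),
        Real.log_sqrt (by positivity), Real.log_mul hdR.ne' hnR.ne'] at h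
      linarith
  refine hlayer.trans (mul_le_mul_of_nonneg_left ?_ (Real.exp_pos _).le)
  have hs : σ = Real.sqrt (σ ^ 2) := (Real.sqrt_sq hσ).symm
  rw [hs, ← Real.sqrt_mul (sq_nonneg σ), ← hs]
  refine Real.sqrt_le_sqrt ?_
  have e1 : 2 * σ ^ 2 / n * mi p X Θ = σ ^ 2 / n * (2 * mi p X Θ) := by ring
  have e2 : σ ^ 2 * (d * Real.log d / n + 2 * Real.log (2 * M) * d / n +
      d * Real.log n / n) = σ ^ 2 / n * (d * Real.log d + 2 * Real.log (2 * M) * d +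
      d * Real.log n) := by ring
  rw [e1, e2]
  exact mul_le_mul_of_nonneg_left (by linarith) (by positivity)

end Stmt3
end
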